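/- For all real α > -1 and -1/2 < β ≤ 0, with ρ_n = h(1)^{-2}·√( ((α+β+2)_n·(α+β+2)_{n+1}) / ((β+1)_n·(β+1)_{n+1}) )·∫₀¹ (h(1)-h(r))·r^{β+n}(1-r)^α dr (the n-th singular value of R_{α,β} = ℙ_{α,β}∘𝒞∘ℙ_{α,β}), for every real p > 1/(α+1) the series ∑_{n=0}^∞ ρ_n^p converges; in particular, if α > -1/2 then ∑_{n=0}^∞ ρ_n² < ∞ (so R_{α,β} is Hilbert–Schmidt). -/

import Mathlib

open MeasureTheory Real Filter

/-- The incomplete beta function h(r) = ∫₀^r t^β (1-t)^α dt. -/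
noncomputable def hfun (α β : ℝ) (r : ℝ) : ℝ := ∫ t in (0:ℝ)..r, t ^ β * (1 - t) ^ α

/-- The ascending factorial (Pochhammer symbol) (a)_n. -/
noncomputable def poch (a : ℝ) (n : ℕ) : ℝ := Polynomial.eval a (ascPochhammer ℝ n)

/-- ρ_n = s_n(R_{α,β}), the singular values of R_{α,β} = ℙ_{α,β}∘𝒞∘ℙ_{α,β}. -/
noncomputable def rho (α β : ℝ) (n : ℕ) : ℝ :=
  (hfun α β 1)⁻¹ ^ 2 *
    Real.sqrt ((poch (α+β+2) n * poch (α+β+2) (n+1)) / (poch (β+1) n * poch (β+1) (n+1))) *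
    ∫ r in (0:ℝ)..1, (hfun α β 1 - hfun α β r) * r ^ (β + (n:ℝ)) * (1 - r) ^ α

open Asymptotics Topology

lemma poch_pos {a : ℝ} (ha : 0 < a) (n : ℕ) : 0 < poch a n :=
  ascPochhammer_pos n a ha

lemma poch_succ (a : ℝ) (n : ℕ) : poch a (n + 1) = poch a n * (a + n) :=
  ascPochhammer_succ_eval n a

lemma poch_eq_prod (a : ℝ) (n : ℕ) : poch a n = ∏ j ∈ Finset.range n, (a + j) := by
  induction n with
  | zero => simp [poch]
  | succ n ih => rw [poch_succ, Finset.prod_range_succ, ih]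

lemma Gamma_add_nat_eq {a : ℝ} (ha : 0 < a) (n : ℕ) :
    Gamma (a + n) = Gamma a * poch a n := by
  induction n with
  | zero => simp [poch]
  | succ n ih =>
    have h : a + n ≠ 0 := by positivity
    rw [poch_succ, Nat.cast_succ, ← add_assoc, Gamma_add_one h, ih]
    ring

lemma tendsto_add_div_add (a b : ℝ) :
    Tendsto (fun n : ℕ => (a + n) / (b + n)) atTop (𝓝 1) := by
  have h := tendsto_add_mul_div_add_mul_atTop_nhds a b (1 : ℝ) one_ne_zero
  simpa using h

/-- The quotient `(a)_n / (b)_n` grows at most like `n ^ (a - b)`. -/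
lemma poch_div_poch_isBigO {a b : ℝ} (ha : 0 < a) (hb : 0 < b) :
    (fun n : ℕ => poch a n / poch b n) =O[atTop] (fun n : ℕ => (n : ℝ) ^ (a - b)) := by
  have hlim : Tendsto (fun n : ℕ => GammaSeq b n / GammaSeq a n * ((b + n) / (a + n))) atTop
      (𝓝 (Gamma b / Gamma a * 1)) :=
    ((GammaSeq_tendsto_Gamma b).div (GammaSeq_tendsto_Gamma a) (Gamma_pos_of_pos ha).ne').mul
      (tendsto_add_div_add b a)
  have h := (isBigO_refl (fun n : ℕ => (n : ℝ) ^ (a - b)) atTop).mul (hlim.isBigO_one ℝ)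
  simp only [mul_one] at h
  refine h.congr' ?_ EventuallyEq.rfl
  filter_upwards [eventually_gt_atTop 0] with n hn
  have hn' : (0 : ℝ) < n := Nat.cast_pos.2 hn
  have h1 := poch_pos ha n
  have h2 := poch_pos hb n
  have h3 : (n.factorial : ℝ) ≠ 0 := by positivity
  have h4 : (n : ℝ) ^ a ≠ 0 := by positivity
  have h5 : (n : ℝ) ^ b ≠ 0 := by positivity
  rw [GammaSeq, GammaSeq, ← poch_eq_prod, ← poch_eq_prod, poch_succ, poch_succ, rpow_sub hn']
  field_simp

lemma poch_succ_div_poch_succ_isBigO {a b : ℝ} (ha : 0 < a) (hb : 0 < b) :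
    (fun n : ℕ => poch a (n + 1) / poch b (n + 1)) =O[atTop]
      (fun n : ℕ => (n : ℝ) ^ (a - b)) := by
  have h := (poch_div_poch_isBigO ha hb).mul ((tendsto_add_div_add a b).isBigO_one ℝ)
  simp only [mul_one] at h
  refine h.congr_left fun n => ?_
  rw [poch_succ, poch_succ, mul_div_mul_comm]

lemma sqrt_poch_isBigO {a b : ℝ} (ha : 0 < a) (hb : 0 < b) :
    (fun n : ℕ => √((poch a n * poch a (n + 1)) / (poch b n * poch b (n + 1)))) =O[atTop]
      (fun n : ℕ => (n : ℝ) ^ (a - b)) := by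
  have h := (poch_div_poch_isBigO ha hb).mul (poch_succ_div_poch_succ_isBigO ha hb)
  have h' := h.rpow (r := 1 / 2) (by norm_num) (Eventually.of_forall fun n => by
    simp only [Pi.zero_apply]; positivity)
  refine h'.congr (fun n => ?_) (fun n => ?_)
  · rw [← sqrt_eq_rpow, mul_div_mul_comm]
  · rw [← sqrt_eq_rpow, sqrt_mul_self (by positivity)]

lemma intervalIntegrable_beta {u v : ℝ} (hu : 0 < u) (hv : 0 < v) :
    IntervalIntegrable (fun x : ℝ => x ^ (u - 1) * (1 - x) ^ (v - 1)) volume 0 1 := by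
  have h := Complex.betaIntegral_convergent (u := u) (v := v) (by simpa) (by simpa)
  rw [intervalIntegrable_iff_integrableOn_Ioc_of_le zero_le_one] at h ⊢
  refine IntegrableOn.congr_fun h.re (fun x hx => ?_) measurableSet_Ioc
  have h0 : 0 ≤ x := hx.1.le
  have h1 : 0 ≤ 1 - x := sub_nonneg.2 hx.2
  have : (x : ℂ) ^ ((u : ℂ) - 1) * (1 - (x : ℂ)) ^ ((v : ℂ) - 1)
      = ((x ^ (u - 1) * (1 - x) ^ (v - 1) : ℝ) : ℂ) := by
    push_cast [Complex.ofReal_cpow h0, Complex.ofReal_cpow h1]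
    rfl
  simp only [this]
  simp

lemma integral_beta {u v : ℝ} (hu : 0 < u) (hv : 0 < v) :
    ∫ x in (0 : ℝ)..1, x ^ (u - 1) * (1 - x) ^ (v - 1) = ProbabilityTheory.beta u v := by
  rw [ProbabilityTheory.beta_eq_betaIntegralReal u v hu hv, Complex.betaIntegral,
    ← Complex.ofReal_re (∫ x in (0 : ℝ)..1, x ^ (u - 1) * (1 - x) ^ (v - 1)),
    ← intervalIntegral.integral_ofReal]
  congr 1
  refine intervalIntegral.integral_congr fun x hx => ?_
  rw [Set.uIcc_of_le zero_le_one] at hx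
  have h0 : 0 ≤ x := hx.1
  have h1 : 0 ≤ 1 - x := sub_nonneg.2 hx.2
  push_cast [Complex.ofReal_cpow h0, Complex.ofReal_cpow h1]
  rfl

section

variable {α β : ℝ}

lemma intervalIntegrable_rpow_mul (hα : -1 < α) (hβ : -1 < β) :
    IntervalIntegrable (fun t : ℝ => t ^ β * (1 - t) ^ α) volume 0 1 := by
  simpa using intervalIntegrable_beta (u := β + 1) (v := α + 1) (by linarith) (by linarith)

lemma integral_one_sub_rpow (hα : -1 < α) (r : ℝ) :
    ∫ t in r..1, (1 - t) ^ α = (1 - r) ^ (α + 1) / (α + 1) := by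
  rw [intervalIntegral.integral_comp_sub_left (fun t : ℝ => t ^ α) 1, integral_rpow (Or.inl hα),
    sub_self, zero_rpow (by linarith), sub_zero]

lemma intervalIntegrable_one_sub_rpow (hα : -1 < α) (r : ℝ) :
    IntervalIntegrable (fun t : ℝ => (1 - t) ^ α) volume r 1 := by
  have h := (intervalIntegral.intervalIntegrable_rpow' (a := 1 - r) (b := 0) hα).comp_sub_left 1
  simpa using h

lemma hfun_one_sub (hα : -1 < α) (hβ : -1 < β) {r : ℝ} (hr : r ∈ Set.Icc (0 : ℝ) 1) :
    hfun α β 1 - hfun α β r = ∫ t in r..1, t ^ β * (1 - t) ^ α := by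
  have h := intervalIntegrable_rpow_mul hα hβ
  refine intervalIntegral.integral_interval_sub_left h (h.mono_set ?_)
  rw [Set.uIcc_of_le hr.1, Set.uIcc_of_le zero_le_one]
  exact Set.Icc_subset_Icc_right hr.2

lemma hfun_one_sub_nonneg (hα : -1 < α) (hβ : -1 < β) {r : ℝ} (hr : r ∈ Set.Icc (0 : ℝ) 1) :
    0 ≤ hfun α β 1 - hfun α β r := by
  rw [hfun_one_sub hα hβ hr]
  refine intervalIntegral.integral_nonneg hr.2 fun t ht => ?_
  exact mul_nonneg (rpow_nonneg (hr.1.trans ht.1) _) (rpow_nonneg (sub_nonneg.2 ht.2) _)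

lemma hfun_one_sub_le (hα : -1 < α) (hβ : -1 < β) (hβ0 : β ≤ 0) {r : ℝ}
    (hr : r ∈ Set.Ioc (0 : ℝ) 1) :
    hfun α β 1 - hfun α β r ≤ r ^ β * ((1 - r) ^ (α + 1) / (α + 1)) := by
  rw [hfun_one_sub hα hβ ⟨hr.1.le, hr.2⟩, ← integral_one_sub_rpow hα,
    ← intervalIntegral.integral_const_mul]
  refine intervalIntegral.integral_mono_on hr.2 ?_
    ((intervalIntegrable_one_sub_rpow hα r).const_mul _) fun t ht => ?_
  · refine (intervalIntegrable_rpow_mul hα hβ).mono_set ?_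
    rw [Set.uIcc_of_le hr.2, Set.uIcc_of_le zero_le_one]
    exact Set.Icc_subset_Icc_left hr.1.le
  · exact mul_le_mul_of_nonneg_right (rpow_le_rpow_of_nonpos hr.1 ht.1 hβ0)
      (rpow_nonneg (sub_nonneg.2 ht.2) _)

lemma integral_hfun_nonneg (hα : -1 < α) (hβ : -1 < β) (n : ℕ) :
    0 ≤ ∫ r in (0:ℝ)..1, (hfun α β 1 - hfun α β r) * r ^ (β + (n:ℝ)) * (1 - r) ^ α := by
  refine intervalIntegral.integral_nonneg zero_le_one fun r hr => ?_
  exact mul_nonneg (mul_nonneg (hfun_one_sub_nonneg hα hβ hr) (rpow_nonneg hr.1 _))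
    (rpow_nonneg (sub_nonneg.2 hr.2) _)

lemma integral_hfun_le (hα : -1 < α) (hβ : -(1 / 2 : ℝ) < β) (hβ0 : β ≤ 0) (n : ℕ) :
    ∫ r in (0:ℝ)..1, (hfun α β 1 - hfun α β r) * r ^ (β + (n:ℝ)) * (1 - r) ^ α ≤
      (α + 1)⁻¹ * ProbabilityTheory.beta (2 * β + 1 + n) (2 * α + 2) := by
  have hβ1 : -1 < β := by linarith
  have hu : 0 < 2 * β + 1 + n := by
    have : (0 : ℝ) ≤ n := n.cast_nonneg
    linarith
  have hv : 0 < 2 * α + 2 := by linarith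
  rw [← integral_beta hu hv, ← intervalIntegral.integral_const_mul,
    intervalIntegral.integral_of_le zero_le_one, intervalIntegral.integral_of_le zero_le_one]
  refine integral_mono_of_nonneg ?_
    (((intervalIntegrable_beta hu hv).const_mul _).1) ?_
  · filter_upwards [ae_restrict_mem measurableSet_Ioc] with r hr
    exact mul_nonneg (mul_nonneg (hfun_one_sub_nonneg hα hβ1 ⟨hr.1.le, hr.2⟩)
      (rpow_nonneg hr.1.le _)) (rpow_nonneg (sub_nonneg.2 hr.2) _)
  · rw [← restrict_Ioo_eq_restrict_Ioc]
    filter_upwards [ae_restrict_mem measurableSet_Ioo] with r hr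
    have h1 : 0 < 1 - r := sub_pos.2 hr.2
    have e1 : r ^ (2 * β + 1 + n - 1) = r ^ β * r ^ (β + n) := by
      rw [← rpow_add hr.1]; ring_nf
    have e2 : (1 - r) ^ (2 * α + 2 - 1) = (1 - r) ^ (α + 1) * (1 - r) ^ α := by
      rw [← rpow_add h1]; ring_nf
    calc (hfun α β 1 - hfun α β r) * r ^ (β + (n:ℝ)) * (1 - r) ^ α
        ≤ r ^ β * ((1 - r) ^ (α + 1) / (α + 1)) * r ^ (β + (n:ℝ)) * (1 - r) ^ α := by
          have := rpow_nonneg hr.1.le (β + n)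
          have := rpow_nonneg h1.le α
          gcongr
          exact hfun_one_sub_le hα hβ1 hβ0 ⟨hr.1, hr.2.le⟩
      _ = _ := by rw [e1, e2]; ring

lemma integral_hfun_isBigO (hα : -1 < α) (hβ : -(1 / 2 : ℝ) < β) (hβ0 : β ≤ 0) :
    (fun n : ℕ => ∫ r in (0:ℝ)..1, (hfun α β 1 - hfun α β r) * r ^ (β + (n:ℝ)) * (1 - r) ^ α)
      =O[atTop] (fun n : ℕ => (n : ℝ) ^ (-(2 * α + 2))) := by
  have hu : 0 < 2 * β + 1 := by linarith
  have hv : 0 < 2 * α + 2 := by linarith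
  have h := poch_div_poch_isBigO hu (add_pos hu hv)
  rw [sub_add_cancel_left] at h
  refine IsBigO.trans ?_ (h.const_mul_left
    ((α + 1)⁻¹ * ProbabilityTheory.beta (2 * β + 1) (2 * α + 2)))
  refine IsBigO.of_norm_le fun n => ?_
  rw [norm_of_nonneg (integral_hfun_nonneg hα (by linarith) n)]
  refine (integral_hfun_le hα hβ hβ0 n).trans_eq ?_
  have e : 2 * β + 1 + n + (2 * α + 2) = 2 * β + 1 + (2 * α + 2) + n := by ring
  rw [ProbabilityTheory.beta, ProbabilityTheory.beta, e, Gamma_add_nat_eq hu,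
    Gamma_add_nat_eq (add_pos hu hv)]
  ring

/-- The singular values decay at least like `n ^ (-(α + 1))`. -/
lemma rho_isBigO (hα : -1 < α) (hβ : -(1 / 2 : ℝ) < β) (hβ0 : β ≤ 0) :
    rho α β =O[atTop] (fun n : ℕ => (n : ℝ) ^ (-(α + 1))) := by
  have h := ((sqrt_poch_isBigO (a := α + β + 2) (b := β + 1) (by linarith)
    (by linarith)).const_mul_left ((hfun α β 1)⁻¹ ^ 2)).mul (integral_hfun_isBigO hα hβ hβ0)
  refine h.congr' EventuallyEq.rfl ?_
  filter_upwards [eventually_gt_atTop 0] with n hn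
  rw [← rpow_add (Nat.cast_pos.2 hn)]
  ring_nf

lemma summable_rho_rpow (hα : -1 < α) (hβ : -(1 / 2 : ℝ) < β) (hβ0 : β ≤ 0) {p : ℝ}
    (hp : 1 / (α + 1) < p) : Summable (fun n : ℕ => rho α β n ^ p) := by
  have hα1 : 0 < α + 1 := by linarith
  have hp0 : 0 < p := (by positivity : 0 < 1 / (α + 1)).trans hp
  have hs : -(α + 1) * p < -1 := by
    rw [div_lt_iff₀ hα1] at hp
    linarith
  refine summable_of_isBigO_nat (summable_nat_rpow.2 hs) ?_
  refine ((rho_isBigO hα hβ hβ0).rpow hp0.le (Eventually.of_forall fun n => by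
    simp only [Pi.zero_apply]; positivity)).congr_right fun n => ?_
  rw [rpow_mul n.cast_nonneg]

end

/-- For p > 1/(α+1) the series ∑ ρ_nᵖ converges (R_{α,β} is in the p-th Schatten class);
in particular for α > -1/2, ∑ ρ_n² < ∞ (R_{α,β} is Hilbert–Schmidt). -/
theorem R_schatten (α β : ℝ) (hα : -1 < α) (hβ1 : -(1/2 : ℝ) < β) (hβ2 : β ≤ 0) :
    (∀ p : ℝ, 1 / (α + 1) < p → Summable (fun n : ℕ => rho α β n ^ p)) ∧
    (-(1/2 : ℝ) < α → Summable (fun n : ℕ => rho α β n ^ 2)) := by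
  refine ⟨fun p hp => summable_rho_rpow hα hβ1 hβ2 hp, fun hα2 => ?_⟩
  have h2 : 1 / (α + 1) < 2 := by
    rw [div_lt_iff₀ (by linarith)]
    linarith
  simpa using summable_rho_rpow hα hβ1 hβ2 h2
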